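/- arXiv:1504.04111 — 3 statements merged into one kernel-verified Lean document; each statement's English description precedes it below -/
import Mathlib

section
/- Let k ≥ 1, write m_k = u_1u_2⋯u_k ∈ R_k, let γ be a real number, and define w : R_k → ℝ by w(0) = 0, w(m_k) = 2γ, and w(x) = γ for all other x ∈ R_k. Then w is a homogeneous weight on R_k, i.e.: (H1) for all x, y ∈ R_k, if the principal ideals (x) and (y) coincide then w(x) = w(y); and (H2) for every nonzero x ∈ R_k, the sum of w(y) over all y in the principal ideal (x) equals γ times the cardinality of (x). -/
open MvPolynomial

/-- The ring `R_k = F_2[u_1,…,u_k]/(u_i² = 0)`. -/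
abbrev Rk (k : ℕ) : Type :=
  MvPolynomial (Fin k) (ZMod 2) ⧸
    Ideal.span (Set.range fun i : Fin k => (X i : MvPolynomial (Fin k) (ZMod 2)) ^ 2)

/-- The element `m_k = u_1 u_2 ⋯ u_k ∈ R_k`. -/
noncomputable def uProd (k : ℕ) : Rk k :=
  Ideal.Quotient.mk _ (∏ i : Fin k, (X i : MvPolynomial (Fin k) (ZMod 2)))

namespace Rk

variable {k : ℕ}

theorem mem_span_sq_iff {p : MvPolynomial (Fin k) (ZMod 2)} :
    p ∈ Ideal.span (Set.range fun i : Fin k => (X i : MvPolynomial (Fin k) (ZMod 2)) ^ 2) ↔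
      ∀ t ∈ p.support, ∃ i, 2 ≤ t i := by
  have h : (Set.range fun i : Fin k => (X i : MvPolynomial (Fin k) (ZMod 2)) ^ 2) =
      (fun s => monomial s (1 : ZMod 2)) '' Set.range fun i : Fin k => Finsupp.single i 2 := by
    rw [← Set.range_comp]
    congr 1
    funext i
    simp [X_pow_eq_monomial]
  rw [h, mem_ideal_span_monomial_image]
  simp

theorem prod_X_eq_monomial :
    ∏ i : Fin k, (X i : MvPolynomial (Fin k) (ZMod 2)) =
      monomial (Finsupp.equivFunOnFinite.symm 1) 1 := by
  rw [monomial_eq, Finsupp.prod_fintype _ _ (by simp)]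
  simp

theorem uProd_ne_zero : uProd k ≠ 0 := by
  rw [uProd, Ne, Ideal.Quotient.eq_zero_iff_mem, mem_span_sq_iff, prod_X_eq_monomial]
  simp [support_monomial]

theorem mk_X_sq (i : Fin k) : (Ideal.Quotient.mk _ (X i) : Rk k) ^ 2 = 0 := by
  rw [← map_pow, Ideal.Quotient.eq_zero_iff_mem]
  exact Ideal.subset_span ⟨i, rfl⟩

theorem mk_X_mul_uProd (i : Fin k) : (Ideal.Quotient.mk _ (X i) : Rk k) * uProd k = 0 := by
  rw [uProd, ← Finset.mul_prod_erase _ _ (Finset.mem_univ i), map_mul, ← mul_assoc, ← sq,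
    mk_X_sq, zero_mul]

instance : Finite (Rk k) := by
  have : Algebra.IsIntegral (ZMod 2) (Rk k) := by
    refine ⟨fun x => ?_⟩
    obtain ⟨p, rfl⟩ := Ideal.Quotient.mk_surjective x
    induction p using MvPolynomial.induction_on with
    | C a => exact isIntegral_algebraMap (R := ZMod 2) (A := Rk k) (x := a)
    | add p q hp hq => rw [map_add]; exact hp.add hq
    | mul_X p i hp =>
      rw [map_mul]
      refine hp.mul (IsIntegral.of_pow two_pos ?_)
      rw [mk_X_sq]
      exact isIntegral_zero
  have : Module.Finite (ZMod 2) (Rk k) := Algebra.IsIntegral.finite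
  exact Module.finite_of_finite (ZMod 2)

theorem mul_uProd_eq_zero_or (x : Rk k) : x * uProd k = 0 ∨ x * uProd k = uProd k := by
  obtain ⟨p, rfl⟩ := Ideal.Quotient.mk_surjective x
  have h : Ideal.Quotient.mk _ p * uProd k =
      Ideal.Quotient.mk _ (C (constantCoeff p)) * uProd k := by
    induction p using MvPolynomial.induction_on with
    | C a => simp
    | add p q hp hq => simp only [map_add, add_mul, hp, hq]
    | mul_X p i _ => simp [mul_assoc, mk_X_mul_uProd]
  rw [h]
  obtain ha | ha : constantCoeff p = 0 ∨ constantCoeff p = 1 := by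
    generalize constantCoeff p = a
    revert a; decide
  · left; simp [ha]
  · right; simp [ha]

/-- The socle element `m_k` lies in every nonzero principal ideal. -/
theorem uProd_mem_span_singleton {x : Rk k} (hx : x ≠ 0) : uProd k ∈ Ideal.span {x} := by
  obtain ⟨p, rfl⟩ := Ideal.Quotient.mk_surjective x
  rw [Ne, Ideal.Quotient.eq_zero_iff_mem, mem_span_sq_iff] at hx
  push Not at hx
  obtain ⟨s, hs, hmin⟩ := (p.support.filter fun t => ∀ i, t i < 2).exists_min_image
    (fun t => ∑ i, t i) (by obtain ⟨t, ht⟩ := hx; exact ⟨t, by simpa using ht⟩)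
  simp only [Finset.mem_filter] at hs hmin
  rw [Ideal.mem_span_singleton']
  set e : Fin k →₀ ℕ := Finsupp.equivFunOnFinite.symm 1
  have he (i : Fin k) : e i = 1 := rfl
  have hse : e - s + s = e := tsub_add_cancel_of_le fun i => by
    have := hs.2 i; rw [he]; lia
  have hcoeff : coeff s p = 1 := by
    have := mem_support_iff.mp hs.1
    generalize coeff s p = a at *
    revert a; decide
  refine ⟨Ideal.Quotient.mk _ (monomial (e - s) 1), ?_⟩
  rw [uProd, ← map_mul, Ideal.Quotient.mk_eq_mk_iff_sub_mem, mem_span_sq_iff,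
    prod_X_eq_monomial]
  intro t ht
  rw [mem_support_iff, coeff_sub, coeff_monomial_mul', coeff_monomial] at ht
  by_contra! hlt
  apply ht
  change (if e - s ≤ t then 1 * coeff (t - (e - s)) p else 0) - (if e = t then 1 else 0) = 0
  by_cases het : e = t
  · rw [if_pos het, ← het, if_pos tsub_le_self, ← eq_tsub_of_add_eq ((add_comm _ _).trans hse),
      hcoeff]
    simp
  rw [if_neg het, sub_zero]
  split_ifs with hle
  · rw [one_mul]
    by_contra hne
    obtain ⟨r, rfl⟩ := le_iff_exists_add.mp hle
    rw [add_tsub_cancel_left] at hne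
    have hval (i : Fin k) : 1 - s i + r i < 2 := hlt i
    have hsum := hmin r ⟨mem_support_iff.mpr hne, fun i => by have := hval i; lia⟩
    have hrs : ∀ i ∈ Finset.univ, r i ≤ s i := fun i _ => by
      have := hval i; have := hs.2 i; lia
    have hrs_eq := (Finset.sum_eq_sum_iff_of_le hrs).mp ((Finset.sum_le_sum hrs).antisymm hsum)
    have : r = s := Finsupp.ext fun i => hrs_eq i (Finset.mem_univ i)
    exact het (this ▸ hse.symm)
  · rfl

theorem eq_uProd_of_span_eq {x : Rk k} (h : Ideal.span {x} = Ideal.span {uProd k}) :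
    x = uProd k := by
  obtain ⟨r, rfl⟩ := Ideal.mem_span_singleton'.mp (h ▸ Ideal.mem_span_singleton_self x)
  refine (mul_uProd_eq_zero_or r).resolve_left fun h0 => uProd_ne_zero (k := k) ?_
  rwa [h0, Ideal.span_singleton_zero, eq_comm, Ideal.span_singleton_eq_bot] at h

end Rk

theorem homogeneous_weight_Rk (k : ℕ) (hk : 1 ≤ k) (γ : ℝ) (w : Rk k → ℝ)
    (hw0 : w 0 = 0) (hwm : w (uProd k) = 2 * γ)
    (hw : ∀ x : Rk k, x ≠ 0 → x ≠ uProd k → w x = γ) :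
    (∀ x y : Rk k, Ideal.span {x} = Ideal.span {y} → w x = w y) ∧
    (∀ x : Rk k, x ≠ 0 →
      ∑ᶠ y ∈ ((Ideal.span {x} : Ideal (Rk k)) : Set (Rk k)), w y =
        γ * (Nat.card ((Ideal.span {x} : Ideal (Rk k)) : Set (Rk k)) : ℝ)) := by
  classical
  constructor
  · intro x y h
    by_cases hx0 : x = 0
    · subst hx0
      rw [Ideal.span_singleton_zero, eq_comm, Ideal.span_singleton_eq_bot] at h
      rw [h]
    by_cases hy0 : y = 0
    · subst hy0
      rw [Ideal.span_singleton_zero, Ideal.span_singleton_eq_bot] at h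
      exact absurd h hx0
    by_cases hxm : x = uProd k
    · subst hxm
      rw [Rk.eq_uProd_of_span_eq h.symm]
    by_cases hym : y = uProd k
    · subst hym
      exact absurd (Rk.eq_uProd_of_span_eq h) hxm
    rw [hw x hx0 hxm, hw y hy0 hym]
  · intro x hx
    set S : Set (Rk k) := ((Ideal.span {x} : Ideal (Rk k)) : Set (Rk k))
    have hS : S.Finite := S.toFinite
    have hweight (y : Rk k) :
        w y = γ + ((if y = uProd k then γ else 0) - if y = 0 then γ else 0) := by
      by_cases hy0 : y = 0
      · simp [hy0, hw0, Rk.uProd_ne_zero.symm]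
      by_cases hym : y = uProd k
      · simp [hym, hwm, Rk.uProd_ne_zero, two_mul]
      · simp [hy0, hym, hw y hy0 hym]
    have hm : uProd k ∈ hS.toFinset := hS.mem_toFinset.mpr (Rk.uProd_mem_span_singleton hx)
    have h0 : (0 : Rk k) ∈ hS.toFinset := hS.mem_toFinset.mpr (Ideal.zero_mem _)
    rw [finsum_mem_eq_finite_toFinset_sum _ hS, Finset.sum_congr rfl fun y _ => hweight y,
      Finset.sum_add_distrib, Finset.sum_sub_distrib, Finset.sum_ite_eq', Finset.sum_ite_eq',
      if_pos hm, if_pos h0, Finset.sum_const, Nat.card_coe_set_eq, Set.ncard_eq_toFinset_card S hS,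
      nsmul_eq_mul]
    ring
end

section
/- Let k ≥ 1, let λ be a unit of R_k, let ℓ ≥ 1 and let m be an odd positive integer, and set n = ℓ·m. Let C be an R_k-submodule of R_k^n and define the monomial map ν : R_k^n → R_k^n by ν(a)_i = λ^(⌊i/ℓ⌋) · a_i for 0 ≤ i ≤ n−1. Then C is a (λ,ℓ)-quasitwisted code (T_λ^ℓ(C) = C) if and only if ν(C) is an ℓ-quasicyclic code (T^ℓ(ν(C)) = ν(C)). In particular, up to the monomial equivalence ν, (λ,ℓ)-QT codes over R_k of odd coindex m are exactly the ℓ-QC codes. -/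
open MvPolynomial

/-- The `λ`-shift `T_λ(a_0,…,a_{n−1}) = (λa_{n−1}, a_0, …, a_{n−2})`;
`lamShift 1` is the cyclic shift `T`. -/
def lamShift {R : Type*} [CommRing R] {n : ℕ} [NeZero n] (lam : R)
    (a : Fin n → R) : Fin n → R :=
  fun i => if i = 0 then lam * a (i - 1) else a (i - 1)

/-- The square of an element of `R_k` is a constant from `F_2`. -/
theorem Rk.exists_sq_eq_mk_C (k : ℕ) (x : Rk k) :
    ∃ c : ZMod 2, x ^ 2 = Ideal.Quotient.mk _ (C c) := by
  obtain ⟨p, rfl⟩ := Ideal.Quotient.mk_surjective x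
  induction p using MvPolynomial.induction_on with
  | C a => exact ⟨a ^ 2, by rw [C_pow, map_pow]⟩
  | add p q hp hq =>
    obtain ⟨c, hc⟩ := hp
    obtain ⟨d, hd⟩ := hq
    refine ⟨c + d, ?_⟩
    rw [← map_pow, CharTwo.add_sq, map_add, map_pow, map_pow, hc, hd, C_add, map_add]
  | mul_X p i _ =>
    refine ⟨0, ?_⟩
    rw [← map_pow, mul_pow, C_0, map_zero]
    exact Ideal.Quotient.eq_zero_iff_mem.2
      (Ideal.mul_mem_left _ _ (Ideal.subset_span ⟨i, rfl⟩))

theorem Rk.unit_sq_eq_one (k : ℕ) (lam : (Rk k)ˣ) : (lam : Rk k) ^ 2 = 1 := by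
  obtain ⟨c, hc⟩ := Rk.exists_sq_eq_mk_C k (lam : Rk k)
  have h01 : c = 0 ∨ c = 1 := by
    clear hc
    revert c
    decide
  rcases h01 with rfl | rfl
  · rw [C_0, map_zero] at hc
    have hu : IsUnit (0 : Rk k) := hc ▸ lam.isUnit.pow 2
    rw [hc]
    exact isUnit_zero_iff.1 hu
  · rw [hc, C_1, map_one]

theorem Fin.val_sub_one_eq {n : ℕ} [NeZero n] (i : Fin n) :
    ((i - 1 : Fin n) : ℕ) = if i = 0 then n - 1 else (i : ℕ) - 1 := by
  obtain ⟨n, rfl⟩ := Nat.exists_eq_succ_of_ne_zero (NeZero.ne n)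
  rw [Fin.coe_sub_one]
  rfl

/-- Entrywise description of the iterates of the `λ`-shift. -/
theorem lamShift_iterate_apply {R : Type*} [CommRing R] {n : ℕ} [NeZero n] (lam : R)
    (a : Fin n → R) {j : ℕ} (hj : j ≤ n) (i i' : Fin n) :
    ((i : ℕ) < j → (i' : ℕ) + j = n + i → (lamShift lam)^[j] a i = lam * a i') ∧
      ((i' : ℕ) + j = i → (lamShift lam)^[j] a i = a i') := by
  induction j generalizing i i' with
  | zero =>
    refine ⟨fun h => absurd h (Nat.not_lt_zero _), fun h => ?_⟩
    rw [Fin.ext (by omega : (i' : ℕ) = i), Function.iterate_zero_apply]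
  | succ j ih =>
    have hv := Fin.val_sub_one_eq i
    rw [Function.iterate_succ_apply', lamShift]
    by_cases h0 : i = 0
    · have hi : (i : ℕ) = 0 := by rw [h0]; rfl
      rw [if_pos h0] at hv ⊢
      refine ⟨fun _ h => ?_, fun h => by omega⟩
      rw [(ih (by omega) (i - 1) i').2 (by omega)]
    · have hi : (i : ℕ) ≠ 0 := fun h => h0 (Fin.ext h)
      rw [if_neg h0] at hv ⊢
      exact ⟨fun h h' => (ih (by omega) (i - 1) i').1 (by omega) (by omega),
        fun h => (ih (by omega) (i - 1) i').2 (by omega)⟩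

/-- The diagonal map `a ↦ (λ^⌊i/ℓ⌋ a_i)_i` intertwines `T_λ^ℓ` with `λ T^ℓ`. -/
theorem pow_div_mul_lamShift_iterate {R : Type*} [CommRing R] {lam : R} (hlam : lam ^ 2 = 1)
    {ℓ m n : ℕ} (hℓ : 1 ≤ ℓ) (hm : Odd m) (hn : n = ℓ * m) [NeZero n] (a : Fin n → R)
    (i : Fin n) :
    lam ^ ((i : ℕ) / ℓ) * (lamShift lam)^[ℓ] a i =
      (lamShift (1 : R))^[ℓ] (fun j : Fin n => lam ^ ((j : ℕ) / ℓ) * (lam • a) j) i := by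
  obtain ⟨r, rfl⟩ := hm
  have hsplit : n = ℓ * (2 * r) + ℓ := by rw [hn]; ring
  have hle : ℓ ≤ n := by omega
  rcases lt_or_ge (i : ℕ) ℓ with hi | hi
  · let i' : Fin n := ⟨ℓ * (2 * r) + i, by omega⟩
    have hi' : (i' : ℕ) + ℓ = n + i := by simp only [i']; omega
    rw [(lamShift_iterate_apply _ _ hle i i').1 hi hi',
      (lamShift_iterate_apply _ _ hle i i').1 hi hi']
    have hq : (i' : ℕ) / ℓ = 2 * r := by
      simp only [i']
      rw [Nat.mul_add_div hℓ, Nat.div_eq_of_lt hi, add_zero]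
    simp only [hq, Nat.div_eq_of_lt hi, pow_mul, hlam, one_pow, pow_zero, one_mul,
      Pi.smul_apply, smul_eq_mul]
  · let i' : Fin n := ⟨i - ℓ, by omega⟩
    have hi' : (i' : ℕ) + ℓ = i := by simp only [i']; omega
    rw [(lamShift_iterate_apply _ _ hle i i').2 hi',
      (lamShift_iterate_apply _ _ hle i i').2 hi', ← hi', Nat.add_div_right _ hℓ]
    simp only [Pi.smul_apply, smul_eq_mul, pow_succ, mul_assoc]

/-- A unit scales a submodule onto itself. -/
theorem Submodule.image_unit_smul {R M : Type*} [CommRing R] [AddCommGroup M] [Module R M]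
    (u : Rˣ) (N : Submodule R M) : (fun x : M => (u : R) • x) '' (N : Set M) = N := by
  refine Set.Subset.antisymm (Set.image_subset_iff.2 fun x hx => N.smul_mem _ hx) fun x hx =>
    ⟨((u⁻¹ : Rˣ) : R) • x, N.smul_mem _ hx, ?_⟩
  simp only [smul_smul, Units.mul_inv, one_smul]

/-- Quasitwisted codes of odd coindex are equivalent to quasicyclic ones, for a unit `λ` with
`λ² = 1` of any commutative ring. -/
theorem quasitwisted_iff_quasicyclic_of_sq_eq_one {R : Type*} [CommRing R] (lam : Rˣ)
    (hlam : (lam : R) ^ 2 = 1) {ℓ m n : ℕ} (hℓ : 1 ≤ ℓ) (hm : Odd m) (hn : n = ℓ * m)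
    [NeZero n] (C : Submodule R (Fin n → R)) :
    (lamShift (lam : R))^[ℓ] '' (C : Set (Fin n → R)) = (C : Set (Fin n → R)) ↔
    (lamShift (1 : R))^[ℓ] ''
        ((fun (a : Fin n → R) (i : Fin n) => (lam : R) ^ ((i : ℕ) / ℓ) * a i) ''
          (C : Set (Fin n → R))) =
      (fun (a : Fin n → R) (i : Fin n) => (lam : R) ^ ((i : ℕ) / ℓ) * a i) ''
        (C : Set (Fin n → R)) := by
  set ν : (Fin n → R) → (Fin n → R) := fun a i => (lam : R) ^ ((i : ℕ) / ℓ) * a i with hν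
  have hinj : Function.Injective ν := fun a b h => funext fun i =>
    (lam.isUnit.pow ((i : ℕ) / ℓ)).mul_left_cancel (congrFun h i)
  have hcomm (a : Fin n → R) :
      ν ((lamShift (lam : R))^[ℓ] a) = (lamShift (1 : R))^[ℓ] (ν ((lam : R) • a)) :=
    funext fun i => pow_div_mul_lamShift_iterate hlam hℓ hm hn a i
  have himage : ν '' ((lamShift (lam : R))^[ℓ] '' (C : Set (Fin n → R))) =
      (lamShift (1 : R))^[ℓ] '' (ν '' (C : Set (Fin n → R))) := by
    conv_rhs => rw [← Submodule.image_unit_smul lam C]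
    simp only [Set.image_image, hcomm]
  rw [← himage, hinj.image_injective.eq_iff]

set_option synthInstance.maxHeartbeats 1000000 in
theorem quasitwisted_iff_quasicyclic_of_odd_coindex (k : ℕ) (hk : 1 ≤ k)
    (lam : (Rk k)ˣ) (ℓ m n : ℕ) (hℓ : 1 ≤ ℓ) (hm : Odd m) (hn : n = ℓ * m)
    [NeZero n] (C : Submodule (Rk k) (Fin n → Rk k)) :
    (lamShift (lam : Rk k))^[ℓ] '' (C : Set (Fin n → Rk k)) = (C : Set (Fin n → Rk k)) ↔
    (lamShift (1 : Rk k))^[ℓ] ''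
        ((fun (a : Fin n → Rk k) (i : Fin n) => (lam : Rk k) ^ ((i : ℕ) / ℓ) * a i) ''
          (C : Set (Fin n → Rk k))) =
      (fun (a : Fin n → Rk k) (i : Fin n) => (lam : Rk k) ^ ((i : ℕ) / ℓ) * a i) ''
        (C : Set (Fin n → Rk k)) := by
  exact quasitwisted_iff_quasicyclic_of_sq_eq_one lam (Rk.unit_sq_eq_one k lam) hℓ hm hn C
end

section
/- Let k ≥ 1 and let μ : R_k → ZMod 2 denote the residue ring homomorphism of the local ring R_k (so μ(a) = 1 if a is a unit and μ(a) = 0 if a is a non-unit), applied coordinatewise to vectors. Let C be an R_k-submodule of R_k^n. Then: (i) for every c ∈ C, w_hom(c) ≥ 2^(2^k−2) · wt_H(μ(c)), where wt_H denotes Hamming weight; (ii) if μ(C) contains an element of Hamming weight d > 0, then C contains a nonzero codeword whose homogeneous weight is exactly 2^(2^k−1)·d; in particular the minimum homogeneous weight of C is at most 2^(2^k−1)·d. -/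
open MvPolynomial

open Classical in
/-- The homogeneous weight on `R_k` with `γ = 2^(2^k - 2)`. -/
noncomputable def whom (k : ℕ) (x : Rk k) : ℕ :=
  if x = 0 then 0 else if x = uProd k then 2 ^ (2 ^ k - 1) else 2 ^ (2 ^ k - 2)

/-- The element `u_1 ⋯ u_k` of `R_k` is nonzero. -/
theorem uProd_ne_zero (k : ℕ) : uProd k ≠ 0 := by
  intro h
  rw [uProd, Ideal.Quotient.eq_zero_iff_mem] at h
  have hrange : (Set.range fun i : Fin k => (X i : MvPolynomial (Fin k) (ZMod 2)) ^ 2) =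
      (fun s => monomial s (1 : ZMod 2)) '' Set.range fun i : Fin k => Finsupp.single i 2 := by
    rw [← Set.range_comp]
    simp [Function.comp_def, X_pow_eq_monomial]
  have hprod : (∏ i : Fin k, (X i : MvPolynomial (Fin k) (ZMod 2))) =
      monomial (∑ i : Fin k, Finsupp.single i 1) 1 := by
    rw [monomial_sum_one]
    rfl
  rw [hrange, mem_ideal_span_monomial_image, hprod] at h
  obtain ⟨s, ⟨i, rfl⟩, hle⟩ := h (∑ i : Fin k, Finsupp.single i 1)
    (by simp [mem_support_iff])
  have := hle i
  simp [Finsupp.finsetSum_apply, Finsupp.single_apply] at this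

/-- Every variable annihilates `u_1 ⋯ u_k`. -/
theorem uProd_mul_mk_X (k : ℕ) (i : Fin k) :
    uProd k * Ideal.Quotient.mk _ (X i : MvPolynomial (Fin k) (ZMod 2)) = 0 := by
  rw [uProd, ← map_mul, Ideal.Quotient.eq_zero_iff_mem,
    ← Finset.mul_prod_erase Finset.univ _ (Finset.mem_univ i)]
  have hX : (X i : MvPolynomial (Fin k) (ZMod 2)) ^ 2 ∈
      Ideal.span (Set.range fun i : Fin k => (X i : MvPolynomial (Fin k) (ZMod 2)) ^ 2) :=
    Ideal.subset_span ⟨i, rfl⟩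
  convert Ideal.mul_mem_left _
    (∏ j ∈ Finset.univ.erase i, (X j : MvPolynomial (Fin k) (ZMod 2))) hX using 1
  ring

/-- A ring homomorphism from `R_k` to a reduced ring kills the variables. -/
theorem map_mk_X_eq_zero {k : ℕ} {S : Type*} [CommRing S] [IsReduced S] (μ : Rk k →+* S)
    (i : Fin k) :
    μ (Ideal.Quotient.mk _ (X i : MvPolynomial (Fin k) (ZMod 2))) = 0 := by
  refine eq_zero_of_pow_eq_zero (n := 2) ?_
  rw [← map_pow, ← map_pow, Ideal.Quotient.eq_zero_iff_mem.2 (Ideal.subset_span (Set.mem_range_self i)),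
    map_zero]

/-- Multiplying `u_1 ⋯ u_k` by `x` scales it by the residue of `x`. -/
theorem uProd_mul {k : ℕ} (μ : Rk k →+* ZMod 2) (x : Rk k) :
    uProd k * x = if μ x = 0 then 0 else uProd k := by
  have key : uProd k * x = uProd k * Ideal.Quotient.mk _ (C (μ x)) := by
    obtain ⟨p, rfl⟩ := Ideal.Quotient.mk_surjective x
    induction p using MvPolynomial.induction_on with
    | C a =>
      have : μ (Ideal.Quotient.mk _ (C a)) = a :=
        RingHom.congr_fun (Subsingleton.elim
          (μ.comp ((Ideal.Quotient.mk _).comp (C : ZMod 2 →+* MvPolynomial (Fin k) (ZMod 2))))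
          (RingHom.id (ZMod 2))) a
      rw [this]
    | add p q hp hq => simp only [map_add, mul_add, hp, hq]
    | mul_X p i _ =>
      rw [map_mul, map_mul, map_mk_X_eq_zero, mul_zero, map_zero, map_zero, mul_zero,
        mul_left_comm, uProd_mul_mk_X, mul_zero]
  rw [key]
  split_ifs with h
  · simp [h]
  · have h1 : μ x = 1 := Fin.eq_one_of_ne_zero (μ x) h
    rw [h1, map_one C, map_one, mul_one]

/-- The homogeneous weight of a nonzero element is at least `2 ^ (2 ^ k - 2)`. -/
theorem le_whom {k : ℕ} {x : Rk k} (hx : x ≠ 0) : 2 ^ (2 ^ k - 2) ≤ whom k x := by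
  rw [whom, if_neg hx]
  split_ifs
  · exact Nat.pow_le_pow_right two_pos (by omega)
  · exact le_rfl

set_option synthInstance.maxHeartbeats 1000000 in
theorem residue_bounds_on_homogeneous_weight (k : ℕ) (hk : 1 ≤ k)
    (μ : Rk k →+* ZMod 2) (hμ : ∀ a : Rk k, μ a = 1 ↔ IsUnit a)
    (n : ℕ) (C : Submodule (Rk k) (Fin n → Rk k)) :
    (∀ c ∈ C, 2 ^ (2 ^ k - 2) * hammingNorm (fun i => μ (c i)) ≤ ∑ i, whom k (c i)) ∧
    (∀ d : ℕ, 0 < d → (∃ c ∈ C, hammingNorm (fun i => μ (c i)) = d) →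
      ∃ c ∈ C, c ≠ 0 ∧ ∑ i, whom k (c i) = 2 ^ (2 ^ k - 1) * d) := by
  refine ⟨fun c _ => ?_, ?_⟩
  · rw [hammingNorm, Finset.card_filter, Finset.mul_sum]
    refine Finset.sum_le_sum fun i _ => ?_
    split_ifs with h
    · rw [mul_one]
      exact le_whom fun h0 => h (by rw [h0, map_zero])
    · simp
  · rintro d hd ⟨c, hc, rfl⟩
    have hsum : ∑ i, whom k ((uProd k • c) i) =
        2 ^ (2 ^ k - 1) * hammingNorm (fun i => μ (c i)) := by
      rw [hammingNorm, Finset.card_filter, Finset.mul_sum]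
      refine Finset.sum_congr rfl fun i _ => ?_
      rw [Pi.smul_apply, smul_eq_mul, uProd_mul μ]
      by_cases h : μ (c i) = 0
      · simp [h, whom]
      · simp [h, whom, uProd_ne_zero]
    refine ⟨uProd k • c, C.smul_mem _ hc, fun h0 => ?_, hsum⟩
    rw [h0] at hsum
    have hpos : 0 < 2 ^ (2 ^ k - 1) * hammingNorm (fun i => μ (c i)) :=
      Nat.mul_pos (by positivity) hd
    rw [← hsum] at hpos
    simp [whom] at hpos
end
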